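/- In the two-participant tontine fund with a passive administrator, with investments π_1, π_2 ≥ 0 such that π_1 + π_2 > 0 and compensations W_i = (π_1 + π_2) · P_i + π_i · P_3 (i = 1,2), the scheme is actuarially fair for both participants (π_i = E[W_i] for i = 1,2) if and only if π_1 · (1 − q_1·q_2) = (π_1 + π_2) · p_1 · (q_2 + β·p_2) and π_2 · (1 − q_1·q_2) = (π_1 + π_2) · p_2 · (q_1 + (1−β)·p_1). -/

import Mathlib

open MeasureTheory

open ProbabilityTheory

lemma integrable_of_zero_or_one {Ω : Type*} [MeasurableSpace Ω] {μ : Measure Ω}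
    [IsFiniteMeasure μ] {X : Ω → ℝ} (hX : Measurable X) (h01 : ∀ ω, X ω = 0 ∨ X ω = 1) :
    Integrable X μ :=
  Integrable.of_bound hX.aestronglyMeasurable 1
    (.of_forall fun ω => by rcases h01 ω with h | h <;> simp [h])

lemma integral_of_zero_or_one {Ω : Type*} [MeasurableSpace Ω] {μ : Measure Ω}
    {X : Ω → ℝ} (hX : Measurable X) (h01 : ∀ ω, X ω = 0 ∨ X ω = 1) :
    ∫ ω, X ω ∂μ = (μ {ω | X ω = 1}).toReal := by
  have hX_eq : X = Set.indicator {ω | X ω = 1} 1 := by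
    ext ω
    rcases h01 ω with h | h <;> simp [Set.indicator, h]
  have hs : MeasurableSet {ω | X ω = 1} := hX (measurableSet_singleton 1)
  calc ∫ ω, X ω ∂μ = ∫ ω, Set.indicator {ω | X ω = 1} 1 ω ∂μ := by rw [← hX_eq]
    _ = (μ {ω | X ω = 1}).toReal := integral_indicator_one hs

/-- The expectation of a multilinear polynomial in two independent variables. -/
lemma ProbabilityTheory.IndepFun.integral_bilinear {Ω : Type*} [MeasurableSpace Ω]
    {μ : Measure Ω} [IsProbabilityMeasure μ] {X Y : Ω → ℝ} (h : IndepFun X Y μ)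
    (hX : Integrable X μ) (hY : Integrable Y μ) (a b c d : ℝ) :
    ∫ ω, (a + b * X ω + c * Y ω + d * (X ω * Y ω)) ∂μ =
      a + b * ∫ ω, X ω ∂μ + c * ∫ ω, Y ω ∂μ + d * ((∫ ω, X ω ∂μ) * ∫ ω, Y ω ∂μ) := by
  have hXY : Integrable (fun ω => X ω * Y ω) μ := h.integrable_mul hX hY
  rw [integral_add (by fun_prop) (by fun_prop), integral_add (by fun_prop) (by fun_prop),
    integral_add (by fun_prop) (by fun_prop)]
  simp only [integral_const_mul, integral_const, probReal_univ, one_smul]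
  rw [h.integral_fun_mul_eq_mul_integral hX.aestronglyMeasurable hY.aestronglyMeasurable]

/-- Two-participant tontine setup: independent Bernoulli indicators `I1, I2`
with success probabilities `p1, p2 ∈ (0,1)`, and the piecewise relative
compensation vector `(P1, P2, P3)` with sharing parameter `β`. -/
theorem stmt_11 {Ω : Type*} [MeasurableSpace Ω] (μ : Measure Ω) [IsProbabilityMeasure μ]
    (I1 I2 : Ω → ℝ) (hm1 : Measurable I1) (hm2 : Measurable I2)
    (h01I1 : ∀ ω, I1 ω = 0 ∨ I1 ω = 1) (h01I2 : ∀ ω, I2 ω = 0 ∨ I2 ω = 1)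
    (hindep : ProbabilityTheory.IndepFun I1 I2 μ)
    (p1 p2 : ℝ) (hp1 : p1 ∈ Set.Ioo (0 : ℝ) 1) (hp2 : p2 ∈ Set.Ioo (0 : ℝ) 1)
    (hI1 : (μ {ω | I1 ω = 1}).toReal = p1) (hI2 : (μ {ω | I2 ω = 1}).toReal = p2)
    (β : ℝ) (hβ : β ∈ Set.Icc (0 : ℝ) 1)
    (P1 P2 P3 : Ω → ℝ)
    (hP1 : ∀ ω, P1 ω = if I1 ω = 1 then (if I2 ω = 1 then β else 1) else 0)
    (hP2 : ∀ ω, P2 ω = if I2 ω = 1 then (if I1 ω = 1 then 1 - β else 1) else 0)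
    (hP3 : ∀ ω, P3 ω = if I1 ω = 1 then 0 else (if I2 ω = 1 then 0 else 1))
    (π1 π2 : ℝ) (hπ1 : 0 ≤ π1) (hπ2 : 0 ≤ π2) (hpos : 0 < π1 + π2) :
    (π1 = ∫ ω, ((π1 + π2) * P1 ω + π1 * P3 ω) ∂μ ∧
     π2 = ∫ ω, ((π1 + π2) * P2 ω + π2 * P3 ω) ∂μ) ↔
    (π1 * (1 - (1 - p1) * (1 - p2)) = (π1 + π2) * p1 * ((1 - p2) + β * p2) ∧
     π2 * (1 - (1 - p1) * (1 - p2)) = (π1 + π2) * p2 * ((1 - p1) + (1 - β) * p1)) := by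
  have hInt := hindep.integral_bilinear (integrable_of_zero_or_one hm1 h01I1)
    (integrable_of_zero_or_one hm2 h01I2)
  rw [integral_of_zero_or_one hm1 h01I1, integral_of_zero_or_one hm2 h01I2, hI1, hI2] at hInt
  have hW1 : ∀ ω, (π1 + π2) * P1 ω + π1 * P3 ω =
      π1 + π2 * I1 ω + (-π1) * I2 ω + (π1 - (π1 + π2) * (1 - β)) * (I1 ω * I2 ω) := by
    intro ω
    rw [hP1, hP3]
    rcases h01I1 ω with h | h <;> rcases h01I2 ω with h' | h' <;> simp [h, h'] <;> ring
  have hW2 : ∀ ω, (π1 + π2) * P2 ω + π2 * P3 ω =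
      π2 + (-π2) * I1 ω + π1 * I2 ω + (π2 - (π1 + π2) * β) * (I1 ω * I2 ω) := by
    intro ω
    rw [hP2, hP3]
    rcases h01I1 ω with h | h <;> rcases h01I2 ω with h' | h' <;> simp [h, h'] <;> ring
  simp only [hW1, hW2, hInt]
  constructor <;> rintro ⟨h1, h2⟩ <;> constructor <;> linarith
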